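/- arXiv:1603.08235 — 3 statements merged into one kernel-verified Lean document; each statement's English description precedes it below -/
import Mathlib

section
/- Let β : ℝ → ℝ be continuously differentiable and let k > 0 be a constant such that β(|p|²)|η|² + 2β'(|p|²)(p·η)² ≥ k|η|² for all η, p ∈ ℝ². Then for all θ, η ∈ ℝ², (β(|η|²)η − β(|θ|²)θ)·(η−θ) ≥ k|η−θ|². -/
open RealInnerProductSpace

/-- The derivative of `t ↦ ⟪β (‖p‖ ^ 2) • p, d⟫` along the line `p = θ + t • d`. -/
theorem hasDerivAt_inner_smul_line {E : Type*} [NormedAddCommGroup E] [InnerProductSpace ℝ E]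
    {β : ℝ → ℝ} (hβ : Differentiable ℝ β) (θ d : E) (t : ℝ) :
    HasDerivAt (fun s : ℝ => ⟪β (‖θ + s • d‖ ^ 2) • (θ + s • d), d⟫)
      (β (‖θ + t • d‖ ^ 2) * ‖d‖ ^ 2
        + 2 * deriv β (‖θ + t • d‖ ^ 2) * ⟪θ + t • d, d⟫ ^ 2) t := by
  have hline : HasDerivAt (fun s : ℝ => θ + s • d) d t := by
    simpa using ((hasDerivAt_id t).smul_const d).const_add θ
  have hcoeff := (hβ (‖θ + t • d‖ ^ 2)).hasDerivAt.comp t hline.norm_sq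
  refine ((hcoeff.smul hline).inner ℝ (hasDerivAt_const t d)).congr_deriv ?_
  simp only [Function.comp_apply, Pi.smul_apply', inner_zero_right, inner_add_left, real_inner_smul_left,
    real_inner_self_eq_norm_sq]
  ring

theorem stmt2 (β : ℝ → ℝ) (hβ : ContDiff ℝ 1 β) (k : ℝ) (hk : 0 < k)
    (hcoerc : ∀ η p : EuclideanSpace ℝ (Fin 2),
      k * ‖η‖ ^ 2 ≤ β (‖p‖ ^ 2) * ‖η‖ ^ 2 + 2 * deriv β (‖p‖ ^ 2) * ⟪p, η⟫ ^ 2) :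
    ∀ θ η : EuclideanSpace ℝ (Fin 2),
      k * ‖η - θ‖ ^ 2 ≤ ⟪β (‖η‖ ^ 2) • η - β (‖θ‖ ^ 2) • θ, η - θ⟫ := by
  intro θ η
  have hderiv := hasDerivAt_inner_smul_line (hβ.differentiable one_ne_zero) θ (η - θ)
  have hmono := mul_sub_le_image_sub_of_le_deriv (fun t => (hderiv t).differentiableAt)
    (fun t => (hderiv t).deriv.symm ▸ hcoerc (η - θ) (θ + t • (η - θ)))
    zero_le_one
  simpa [inner_sub_left] using hmono
end

section
/- Let β : ℝ → ℝ be continuously differentiable and let k > 0 be a constant such that β(|p|²)|η|² + 2β'(|p|²)(p·η)² ≥ k|η|² for all η, p ∈ ℝ². Let B be a real 2×2 matrix, let ξ ≥ 0, and set A := ξ BᵀB. Then for all θ, η ∈ ℝ², (β(|Bη|²)Aη − β(|Bθ|²)Aθ)·(η−θ) ≥ ξ k |B(η−θ)|². -/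
open RealInnerProductSpace Matrix

theorem hasDerivAt_radial_inner_line {E : Type*} [NormedAddCommGroup E] [InnerProductSpace ℝ E]
    {β : ℝ → ℝ} (hβ : Differentiable ℝ β) (v w : E) (t : ℝ) :
    HasDerivAt (fun s : ℝ => β (‖v + s • w‖ ^ 2) * ⟪v + s • w, w⟫)
      (β (‖v + t • w‖ ^ 2) * ‖w‖ ^ 2 +
        2 * deriv β (‖v + t • w‖ ^ 2) * ⟪v + t • w, w⟫ ^ 2) t := by
  have hline : HasDerivAt (fun s : ℝ => v + s • w) w t := by
    simpa using ((hasDerivAt_id t).smul_const w).const_add v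
  have hcomp := (hβ (‖v + t • w‖ ^ 2)).hasDerivAt.comp t hline.norm_sq
  have hinner := hline.inner ℝ (hasDerivAt_const t w)
  refine (hcomp.mul hinner).congr_deriv ?_
  simp only [Function.comp_apply, inner_zero_right, zero_add, real_inner_self_eq_norm_sq]
  ring

/-- The field `p ↦ β (‖p‖ ^ 2) • p` is strongly monotone when its derivative is coercive. -/
theorem strongly_monotone_of_coercive {E : Type*} [NormedAddCommGroup E] [InnerProductSpace ℝ E]
    {β : ℝ → ℝ} (hβ : Differentiable ℝ β) {k : ℝ}
    (hcoerc : ∀ η p : E,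
      k * ‖η‖ ^ 2 ≤ β (‖p‖ ^ 2) * ‖η‖ ^ 2 + 2 * deriv β (‖p‖ ^ 2) * ⟪p, η⟫ ^ 2) (u v : E) :
    k * ‖u - v‖ ^ 2 ≤ ⟪β (‖u‖ ^ 2) • u - β (‖v‖ ^ 2) • v, u - v⟫ := by
  have hderiv := hasDerivAt_radial_inner_line hβ v (u - v)
  have hmvt := mul_sub_le_image_sub_of_le_deriv (fun t => (hderiv t).differentiableAt)
    (fun t => (hcoerc (u - v) (v + t • (u - v))).trans_eq (hderiv t).deriv.symm)
    (zero_le_one' ℝ)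
  simpa [inner_sub_left, real_inner_smul_left] using hmvt

theorem inner_toEuclideanLin_transpose_mul_self {m n : Type*} [Fintype m] [Fintype n]
    [DecidableEq m] [DecidableEq n] (B : Matrix m n ℝ) (x y : EuclideanSpace ℝ n) :
    ⟪Matrix.toEuclideanLin (Bᵀ * B) x, y⟫ =
      ⟪Matrix.toEuclideanLin B x, Matrix.toEuclideanLin B y⟫ := by
  have hmul : Matrix.toEuclideanLin (Bᵀ * B) x =
      Matrix.toEuclideanLin Bᴴ (Matrix.toEuclideanLin B x) := by
    simp [Matrix.toLpLin_apply, Matrix.mulVec_mulVec, Matrix.conjTranspose_eq_transpose_of_trivial]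
  rw [hmul, Matrix.toEuclideanLin_conjTranspose_eq_adjoint, LinearMap.adjoint_inner_left]

theorem stmt5 (β : ℝ → ℝ) (hβ : ContDiff ℝ 1 β) (k : ℝ) (hk : 0 < k)
    (hcoerc : ∀ η p : EuclideanSpace ℝ (Fin 2),
      k * ‖η‖ ^ 2 ≤ β (‖p‖ ^ 2) * ‖η‖ ^ 2 + 2 * deriv β (‖p‖ ^ 2) * ⟪p, η⟫ ^ 2)
    (B : Matrix (Fin 2) (Fin 2) ℝ) (ξ : ℝ) (hξ : 0 ≤ ξ)
    (A : Matrix (Fin 2) (Fin 2) ℝ) (hA : A = ξ • (Bᵀ * B)) :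
    ∀ θ η : EuclideanSpace ℝ (Fin 2),
      ξ * k * ‖Matrix.toEuclideanLin B (η - θ)‖ ^ 2 ≤
        ⟪β (‖Matrix.toEuclideanLin B η‖ ^ 2) • Matrix.toEuclideanLin A η -
          β (‖Matrix.toEuclideanLin B θ‖ ^ 2) • Matrix.toEuclideanLin A θ, η - θ⟫ := by
  intro θ η
  have hmono := mul_le_mul_of_nonneg_left
    (strongly_monotone_of_coercive (hβ.differentiable one_ne_zero) hcoerc
      (Matrix.toEuclideanLin B η) (Matrix.toEuclideanLin B θ)) hξ
  rw [← map_sub, ← mul_assoc] at hmono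
  refine hmono.trans_eq ?_
  subst hA
  simp only [map_smul, LinearMap.smul_apply, inner_sub_left, real_inner_smul_left,
    inner_toEuclideanLin_transpose_mul_self]
  ring
end

section
/- Let H be a real Hilbert space and let C ⊆ H be a nonempty, closed, bounded, convex set with 0 ∉ C. Then the function G ↦ sup_{Z∈C} ⟨Z, G⟩ attains its minimum over the unit sphere {G ∈ H : ‖G‖ = 1} at exactly one point, namely at G = −Ẑ/‖Ẑ‖, where Ẑ ∈ C is the unique element of C of minimal norm. -/
open RealInnerProductSpace

/-- The variational inequality for an element of minimal norm of a convex set. -/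
theorem norm_sq_le_inner_of_forall_norm_le {H : Type*} [NormedAddCommGroup H]
    [InnerProductSpace ℝ H] {C : Set H} (hC : Convex ℝ C) {z : H} (hz : z ∈ C)
    (hmin : ∀ w ∈ C, ‖z‖ ≤ ‖w‖) {w : H} (hw : w ∈ C) : ‖z‖ ^ 2 ≤ ⟪w, z⟫ := by
  have : Nonempty C := ⟨⟨z, hz⟩⟩
  have hInf : ‖(0 : H) - z‖ = ⨅ w : C, ‖(0 : H) - w‖ := by
    refine le_antisymm (le_ciInf fun w => by simpa using hmin w w.2) ?_
    exact ciInf_le (f := fun w : C => ‖(0 : H) - w‖)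
      ⟨0, by rintro _ ⟨w, rfl⟩; exact norm_nonneg _⟩ ⟨z, hz⟩
  have hle := (norm_eq_iInf_iff_real_inner_le_zero hC hz).1 hInf w hw
  rw [zero_sub, inner_neg_left, inner_sub_right, real_inner_self_eq_norm_sq,
    real_inner_comm] at hle
  linarith

/-- A linear functional given by an inner product is bounded above on bounded sets. -/
theorem Bornology.IsBounded.bddAbove_image_inner {H : Type*} [NormedAddCommGroup H]
    [InnerProductSpace ℝ H] {C : Set H} (hC : Bornology.IsBounded C) (x : H) :
    BddAbove ((fun z => ⟪z, x⟫) '' C) := by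
  obtain ⟨R, hR⟩ := hC.exists_norm_le
  refine ⟨R * ‖x‖, ?_⟩
  rintro _ ⟨z, hz, rfl⟩
  exact (real_inner_le_norm z x).trans (by gcongr; exact hR z hz)

theorem stmt12 {H : Type*} [NormedAddCommGroup H] [InnerProductSpace ℝ H]
    [CompleteSpace H] (C : Set H) (hCne : C.Nonempty) (hCcl : IsClosed C)
    (hCb : Bornology.IsBounded C) (hCconv : Convex ℝ C) (h0 : (0 : H) ∉ C)
    (Zhat : H) (hZmem : Zhat ∈ C) (hZmin : ∀ Z ∈ C, ‖Zhat‖ ≤ ‖Z‖)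
    (g₀ : H) (hg₀ : g₀ = -(‖Zhat‖⁻¹ • Zhat)) :
    ‖g₀‖ = 1 ∧
      (∀ X : H, ‖X‖ = 1 →
        sSup ((fun Z => ⟪Z, g₀⟫) '' C) ≤ sSup ((fun Z => ⟪Z, X⟫) '' C)) ∧
      (∀ X : H, ‖X‖ = 1 →
        sSup ((fun Z => ⟪Z, X⟫) '' C) ≤ sSup ((fun Z => ⟪Z, g₀⟫) '' C) →
        X = g₀) := by
  have hZ0 : Zhat ≠ 0 := fun h => h0 (h ▸ hZmem)
  have hpos : 0 < ‖Zhat‖ := norm_pos_iff.2 hZ0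
  have hnorm : ‖g₀‖ = 1 := by
    rw [hg₀, norm_neg, norm_smul, norm_inv, norm_norm, inv_mul_cancel₀ hpos.ne']
  have hZhat : Zhat = -(‖Zhat‖ • g₀) := by
    rw [hg₀, smul_neg, neg_neg, smul_inv_smul₀ hpos.ne']
  have hsup : sSup ((fun Z => ⟪Z, g₀⟫) '' C) ≤ -‖Zhat‖ := by
    refine csSup_le (hCne.image _) ?_
    rintro _ ⟨Z, hZ, rfl⟩
    have hvar := norm_sq_le_inner_of_forall_norm_le hCconv hZmem hZmin hZ
    have hinner : ⟪Z, Zhat⟫ = -(‖Zhat‖ * ⟪Z, g₀⟫) := by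
      conv_lhs => rw [hZhat]
      rw [inner_neg_right, real_inner_smul_right]
    rw [hinner] at hvar
    change ⟪Z, g₀⟫ ≤ -‖Zhat‖
    nlinarith
  have hlower (X : H) : -(‖Zhat‖ * ⟪g₀, X⟫) ≤ sSup ((fun Z => ⟪Z, X⟫) '' C) := by
    refine le_csSup (hCb.bddAbove_image_inner X) ⟨Zhat, hZmem, ?_⟩
    change ⟪Zhat, X⟫ = _
    conv_lhs => rw [hZhat]
    rw [inner_neg_left, real_inner_smul_left]
  have hcs (X : H) (hX : ‖X‖ = 1) : ⟪g₀, X⟫ ≤ 1 := by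
    simpa [hnorm, hX] using real_inner_le_norm g₀ X
  refine ⟨hnorm, fun X hX => ?_, fun X hX hle => ?_⟩
  · have := hlower X
    have := hcs X hX
    nlinarith
  · have := hlower X
    have hge : 1 ≤ ⟪g₀, X⟫ := by
      by_contra! hlt
      nlinarith
    exact ((inner_eq_one_iff_of_norm_eq_one hnorm hX).1 ((hcs X hX).antisymm hge)).symm
end
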